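/- Let S be a type and R : S → S → Prop a transition relation. Define the world relation R' on S ⊕ Unit by: R' (Sum.inl x) (Sum.inl y) ↔ R x y, R' (Sum.inl x) (Sum.inr ()) holds for every x : S, and R' (Sum.inr ()) z holds for no z; and define the agent-subdomain relation R_A on S ⊕ Unit by R_A a b ↔ ∃ x y : S, a = Sum.inl x ∧ b = Sum.inl y ∧ R x y. Then for every s0 : S, the set { s' : S ⊕ Unit | Relation.ReflTransGen R' (Sum.inl s0) s' ∧ ¬ Relation.ReflTransGen R_A (Sum.inl s0) s' } is exactly the singleton { Sum.inr () }. -/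

import Mathlib

/-- Hardness construction of Theorem 2: the difference set
Γ_W(s0) \ Γ_A(s0) of the constructed instance is exactly the singleton
consisting of the fresh goal state. -/
theorem difference_set_is_new_goal {S : Type*} (R : S → S → Prop)
    (R' : S ⊕ Unit → S ⊕ Unit → Prop)
    (h_old : ∀ x y : S, R' (Sum.inl x) (Sum.inl y) ↔ R x y)
    (h_new : ∀ x : S, R' (Sum.inl x) (Sum.inr ()))
    (h_sink : ∀ z : S ⊕ Unit, ¬ R' (Sum.inr ()) z)
    (R_A : S ⊕ Unit → S ⊕ Unit → Prop)
    (h_A : ∀ a b : S ⊕ Unit, R_A a b ↔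
      ∃ x y : S, a = Sum.inl x ∧ b = Sum.inl y ∧ R x y) :
    ∀ s0 : S,
      { s' : S ⊕ Unit | Relation.ReflTransGen R' (Sum.inl s0) s' ∧
        ¬ Relation.ReflTransGen R_A (Sum.inl s0) s' } = {Sum.inr ()} := by
  intro s0
  have reach_old : ∀ s' : S ⊕ Unit, Relation.ReflTransGen R' (Sum.inl s0) s' →
      ∀ y : S, s' = Sum.inl y → Relation.ReflTransGen R_A (Sum.inl s0) s' := by
    intro s' h
    induction h with
    | refl => exact fun _ _ => .refl
    | @tail b c _ hbc ih =>
      rintro y rfl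
      cases b with
      | inl x => exact (ih x rfl).tail ((h_A _ _).2 ⟨x, y, rfl, rfl, (h_old x y).1 hbc⟩)
      | inr u => exact (h_sink _ hbc).elim
  ext s'
  simp only [Set.mem_ofPred_eq, Set.mem_singleton_iff]
  constructor
  · rintro ⟨hW, hA⟩
    cases s' with
    | inl y => exact (hA (reach_old _ hW y rfl)).elim
    | inr u => rfl
  · rintro rfl
    refine ⟨.single (h_new s0), fun h => ?_⟩
    rcases h.cases_tail with h | ⟨b, _, h⟩
    · cases h
    · obtain ⟨x, y, _, hy, _⟩ := (h_A _ _).1 h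
      cases hy
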